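/- arXiv:1706.01227 — 2 statements merged into one kernel-verified Lean document; each statement's English description precedes it below -/
import Mathlib

section
/- Let a ∈ ℚ₂ with ‖a‖ > 1 and suppose there exists b ∈ ℚ₂ with b² = 1 - a. Let J = {x ∈ ℚ₂ : ∀ n, ‖φ^[n](x)‖ = 1/√‖a‖}. Then: (1) φ maps J into J; (2) there is a homeomorphism h : J ≃ₜ Σ₂ such that h(φ(x)) = σ(h(x)) for all x ∈ J, i.e. (J, φ) is topologically conjugate to the full shift on two symbols; (3) for every x ∈ ℚ₂ \ J, the iterates ψ^[n](x) tend to ∞ in OnePoint ℚ₂. -/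
open Filter Topology OnePoint Set

/-- The rational map `φ(x) = a·x + 1/x` on `ℚ₂` (with the convention `0⁻¹ = 0`). -/
noncomputable def phi (a : ℚ_[2]) (x : ℚ_[2]) : ℚ_[2] := a * x + x⁻¹

open scoped Classical in
/-- The rational map `x ↦ a·x + 1/x` on the projective line `P¹(ℚ₂) = OnePoint ℚ₂`:
`ψ(∞) = ∞`, `ψ(0) = ∞`, and `ψ(x) = a·x + x⁻¹` for nonzero `x ∈ ℚ₂`. -/
noncomputable def psi (a : ℚ_[2]) : OnePoint ℚ_[2] → OnePoint ℚ_[2] :=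
  fun z => OnePoint.rec ∞
    (fun x => if x = 0 then ∞ else ((a * x + x⁻¹ : ℚ_[2]) : OnePoint ℚ_[2])) z

/-- The shift map on the full shift space `Σ₂ = ℕ → Fin 2`. -/
def shift2 (s : ℕ → Fin 2) : ℕ → Fin 2 := fun n => s (n + 1)

/-! ### Residues of 2-adic units modulo 4 -/

/-- The norm on `ℚ₂` takes no value strictly between `1 / 2` and `1`. -/
lemma Padic.norm_le_half_of_norm_lt_one {x : ℚ_[2]} (hx : ‖x‖ < 1) : ‖x‖ ≤ 1 / 2 := by
  have h := (Padic.norm_le_pow_iff_norm_lt_pow_add_one x (-1)).2 (by simpa using hx)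
  simpa using h

/-- The norm on `ℚ₂` takes no value strictly between `1` and `2`. -/
lemma Padic.two_le_norm_of_one_lt_norm {x : ℚ_[2]} (hx : 1 < ‖x‖) : 2 ≤ ‖x‖ := by
  by_contra! h
  have := (Padic.norm_le_pow_iff_norm_lt_pow_add_one x 0).2 (by simpa using h)
  simp only [zpow_zero] at this
  linarith

lemma Padic.norm_two : ‖(2 : ℚ_[2])‖ = 1 / 2 := by
  simpa using Padic.norm_p (p := 2)

lemma Padic.norm_sub_one_le_half {u : ℚ_[2]} (hu : ‖u‖ = 1) : ‖u - 1‖ ≤ 1 / 2 := by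
  apply Padic.norm_le_half_of_norm_lt_one
  have key : ∀ y : ℤ_[2], ‖(y : ℚ_[2])‖ = 1 → ‖(y : ℚ_[2]) - 1‖ < 1 := by
    intro y hy
    obtain ⟨n, hn, hmem⟩ := PadicInt.exists_mem_range y
    rw [PadicInt.maximalIdeal_eq_span_p, Ideal.mem_span_singleton,
      ← PadicInt.norm_lt_one_iff_dvd, PadicInt.norm_def, PadicInt.coe_sub,
      PadicInt.coe_natCast] at hmem
    interval_cases n
    · rw [Nat.cast_zero, sub_zero, hy] at hmem
      exact absurd hmem (lt_irrefl 1)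
    · rwa [Nat.cast_one] at hmem
  exact key ⟨u, hu.le⟩ hu

/-- A 2-adic unit is congruent to `1` or to `-1` modulo `4`. -/
lemma Padic.norm_sub_one_le_or_norm_add_one_le {u : ℚ_[2]} (hu : ‖u‖ = 1) :
    ‖u - 1‖ ≤ 1 / 4 ∨ ‖u + 1‖ ≤ 1 / 4 := by
  have h2 := Padic.norm_two
  have h := Padic.norm_sub_one_le_half hu
  set t : ℚ_[2] := (u - 1) / 2 with ht
  have hut : u - 1 = 2 * t := by rw [ht]; ring
  have hut' : u + 1 = 2 * ((t - 1) + 2) := by rw [ht]; ring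
  have hnt : ‖t‖ ≤ 1 := by rw [hut, norm_mul, h2] at h; linarith
  rcases hnt.lt_or_eq with hlt | heq
  · left
    rw [hut, norm_mul, h2]
    linarith [Padic.norm_le_half_of_norm_lt_one hlt]
  · right
    rw [hut', norm_mul, h2]
    have := (Padic.nonarchimedean (t - 1) 2).trans
      (max_le (Padic.norm_sub_one_le_half heq) h2.le)
    linarith

lemma Padic.norm_add_one_eq_half {u : ℚ_[2]} (hu : ‖u - 1‖ ≤ 1 / 4) : ‖u + 1‖ = 1 / 2 := by
  have h2 := Padic.norm_two
  have h : u + 1 = (u - 1) + 2 := by ring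
  rw [h, Padic.add_eq_max_of_ne (by rw [h2]; intro h; linarith), h2]
  exact max_eq_right (by linarith)

lemma Padic.norm_eq_one_of_norm_sub_one_lt {u : ℚ_[2]} (hu : ‖u - 1‖ < 1) : ‖u‖ = 1 := by
  have h : u = (u - 1) + 1 := by ring
  rw [h, Padic.add_eq_max_of_ne (by rw [norm_one]; exact hu.ne), norm_one]
  exact max_eq_right hu.le

lemma Padic.norm_sq_sub_one_le {u : ℚ_[2]} (hu : ‖u‖ = 1) : ‖u ^ 2 - 1‖ ≤ 1 / 8 := by
  have h : u ^ 2 - 1 = (u - 1) * (u + 1) := by ring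
  rw [h, norm_mul]
  rcases Padic.norm_sub_one_le_or_norm_add_one_le hu with h1 | h1
  · rw [Padic.norm_add_one_eq_half h1]; linarith
  · have h3 : ‖-u + 1‖ = 1 / 2 := Padic.norm_add_one_eq_half (by
      rwa [show -u - 1 = -(u + 1) by ring, norm_neg])
    rw [show u - 1 = -(-u + 1) by ring, norm_neg, h3]; linarith

/-- The square root of a 2-adic number close to `1`. -/
lemma Padic.exists_sq_eq_one_add {e : ℚ_[2]} (he : ‖e‖ < 1 / 4) :
    ∃ z : ℚ_[2], z ^ 2 = 1 + e ∧ ‖z - 1‖ = 2 * ‖e‖ := by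
  have h2 : ‖(2 : ℤ_[2])‖ = 1 / 2 := by simpa using PadicInt.norm_p (p := 2)
  let ε : ℤ_[2] := ⟨e, by linarith⟩
  obtain ⟨z, hz, hz1, -⟩ := hensels_lemma (R := ℤ_[2]) (p := 2)
    (F := Polynomial.X ^ 2 - Polynomial.C (1 + ε)) (a := 1) (by
      have hF : (1 : ℤ_[2]) ^ 2 - (1 + ε) = -ε := by ring
      have hε : ‖ε‖ = ‖e‖ := rfl
      simp only [map_sub, map_pow, Polynomial.aeval_X, Polynomial.derivative_X_pow,
        Polynomial.derivative_C, Polynomial.aeval_C, Algebra.algebraMap_self, RingHom.id_apply,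
        hF, norm_neg, hε]
      simp [h2]
      linarith)
  simp only [map_sub, map_pow, Polynomial.aeval_X,
    Polynomial.derivative_X_pow, Polynomial.derivative_C, Polynomial.aeval_C] at hz hz1
  have hz' : z ^ 2 = 1 + ε := by simpa [sub_eq_zero] using hz
  have hsq : (z : ℚ_[2]) ^ 2 = 1 + e := by
    have h := congrArg (fun y : ℤ_[2] => (y : ℚ_[2])) hz'
    rwa [PadicInt.coe_pow, PadicInt.coe_add, PadicInt.coe_one] at h
  have hz1' : ‖(z : ℚ_[2]) - 1‖ < 1 / 2 := by
    have h : ‖z - 1‖ < 1 / 2 := by simpa [h2] using hz1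
    rwa [PadicInt.norm_def, PadicInt.coe_sub, PadicInt.coe_one] at h
  refine ⟨z, hsq, ?_⟩
  have hadd : ‖(z : ℚ_[2]) + 1‖ = 1 / 2 := by
    have h : (z : ℚ_[2]) + 1 = (z - 1) + 2 := by ring
    rw [h, Padic.add_eq_max_of_ne (by rw [Padic.norm_two]; exact hz1'.ne), Padic.norm_two]
    exact max_eq_right hz1'.le
  have h : e = ((z : ℚ_[2]) - 1) * (z + 1) := by linear_combination -hsq
  rw [h, norm_mul, hadd]; ring

/-! ### The renormalised map `u ↦ a·u + (1 - a)/u` on 2-adic units -/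

/-- The conjugate of `phi a` by multiplication with a square root of `1 - a`. -/
noncomputable def phiUnit (a u : ℚ_[2]) : ℚ_[2] := a * u + (1 - a) * u⁻¹

lemma mul_phi {a b : ℚ_[2]} (hb : b ^ 2 = 1 - a) (x : ℚ_[2]) :
    b * phi a x = phiUnit a (b * x) := by
  rw [phi, phiUnit, ← hb, mul_inv]
  by_cases h : b = 0
  · simp [h]
  · field_simp

lemma phiUnit_neg (a u : ℚ_[2]) : phiUnit a (-u) = -phiUnit a u := by
  simp only [phiUnit, inv_neg]; ring

/-- On each residue class modulo `4`, `phiUnit a` expands distances by `‖a‖ / 2`. -/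
lemma norm_phiUnit_sub {a u v : ℚ_[2]} (ha : 4 ≤ ‖a‖) (hu : ‖u‖ = 1) (hv : ‖v‖ = 1)
    (huv : ‖u - v‖ ≤ 1 / 4) : ‖phiUnit a u - phiUnit a v‖ = ‖a‖ / 2 * ‖u - v‖ := by
  have hu0 : u ≠ 0 := norm_ne_zero_iff.1 (by rw [hu]; exact one_ne_zero)
  have hv0 : v ≠ 0 := norm_ne_zero_iff.1 (by rw [hv]; exact one_ne_zero)
  have key : phiUnit a u - phiUnit a v = (u - v) * (a * (u * v + 1) + -1) * (u * v)⁻¹ := by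
    simp only [phiUnit]; field_simp; ring
  have h1 : ‖u * v - 1‖ ≤ 1 / 4 := by
    rw [show u * v - 1 = (u ^ 2 - 1) + -(u * (u - v)) by ring]
    refine (Padic.nonarchimedean _ _).trans (max_le ?_ ?_)
    · linarith [Padic.norm_sq_sub_one_le hu]
    · rwa [norm_neg, norm_mul, hu, one_mul]
  have h3 : ‖a * (u * v + 1)‖ = ‖a‖ / 2 := by
    rw [norm_mul, Padic.norm_add_one_eq_half h1]; ring
  have h4 : ‖a * (u * v + 1) + -1‖ = ‖a‖ / 2 := by
    rw [Padic.add_eq_max_of_ne (by rw [h3, norm_neg, norm_one]; intro h; linarith), h3, norm_neg,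
      norm_one]
    exact max_eq_left (by linarith)
  rw [key, norm_mul, norm_mul, h4, norm_inv, norm_mul, hu, hv]; ring

/-- The inverse branch of `phiUnit a` with values congruent to `1` modulo `4`. -/
lemma exists_phiUnit_eq {a w : ℚ_[2]} (ha : 4 ≤ ‖a‖) (hw : ‖w‖ = 1) :
    ∃ u : ℚ_[2], ‖u - 1‖ ≤ 1 / 4 ∧ phiUnit a u = w := by
  have h2 := Padic.norm_two
  set m : ℚ_[2] := 2 * a + -1 with hm
  have h2a : ‖2 * a‖ = ‖a‖ / 2 := by rw [norm_mul, h2]; ring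
  have hM : ‖m‖ = ‖a‖ / 2 := by
    rw [hm, Padic.add_eq_max_of_ne (by rw [h2a, norm_neg, norm_one]; intro h; linarith), h2a,
      norm_neg, norm_one]
    exact max_eq_left (by linarith)
  have hm0 : m ≠ 0 := norm_ne_zero_iff.1 (by rw [hM]; intro h; linarith)
  have hw8 := Padic.norm_sq_sub_one_le hw
  have hM2 : 2 ≤ ‖m‖ := by rw [hM]; linarith
  have hne : ‖(w ^ 2 - 1) / m ^ 2‖ * ‖m‖ ^ 2 = ‖w ^ 2 - 1‖ := by
    rw [← norm_pow, ← norm_mul, div_mul_cancel₀ _ (pow_ne_zero 2 hm0)]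
  obtain ⟨z, hz, hz1⟩ := Padic.exists_sq_eq_one_add (e := (w ^ 2 - 1) / m ^ 2) (by
    nlinarith [norm_nonneg ((w ^ 2 - 1) / m ^ 2)])
  have hmz : (m * z) ^ 2 = m ^ 2 + (w ^ 2 - 1) := by
    rw [mul_pow, hz, mul_add, mul_one, mul_div_cancel₀ _ (pow_ne_zero 2 hm0)]
  have hmz1 : ‖m * (z - 1)‖ ≤ 1 / 2 := by
    rw [norm_mul, hz1]
    nlinarith [norm_nonneg ((w ^ 2 - 1) / m ^ 2)]
  have h2a0 : 2 * a ≠ 0 := norm_ne_zero_iff.1 (by rw [h2a]; intro h; linarith)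
  set u : ℚ_[2] := (w + m * z) / (2 * a) with hu
  have hua : 2 * a * u = w + m * z := by rw [hu, mul_div_cancel₀ _ h2a0]
  have hu1 : ‖u - 1‖ ≤ 1 / 4 := by
    have h : 2 * a * (u - 1) = (w - 1) + m * (z - 1) := by rw [mul_sub, hua, hm]; ring
    have h' : ‖2 * a * (u - 1)‖ ≤ 1 / 2 := by
      rw [h]
      exact (Padic.nonarchimedean _ _).trans (max_le (Padic.norm_sub_one_le_half hw) hmz1)
    rw [norm_mul, h2a] at h'
    nlinarith [norm_nonneg (u - 1)]
  refine ⟨u, hu1, ?_⟩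
  have hu0 : u ≠ 0 := norm_ne_zero_iff.1 (by
    rw [Padic.norm_eq_one_of_norm_sub_one_lt (hu1.trans_lt (by norm_num))]; exact one_ne_zero)
  have hquad : a * u ^ 2 + (1 - a) = w * u := by
    have h4 : 2 * (2 * a) * (a * u ^ 2 + (1 - a)) = 2 * (2 * a) * (w * u) := by
      linear_combination (2 * a * u + m * z - w) * hua + hmz + (m + 2 * a - 1) * hm
    exact mul_left_cancel₀ (mul_ne_zero two_ne_zero h2a0) h4
  rw [phiUnit]
  field_simp
  linear_combination hquad

/-! ### A criterion for conjugacy with the full shift -/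

/-- A compact system with a continuous two-letter coding that separates orbits, and in which every
point has a preimage carrying each letter, is conjugate to the full shift. -/
lemma exists_homeomorph_shift2 {X : Type*} [TopologicalSpace X] [CompactSpace X] [Nonempty X]
    {F : X → X} {e : X → Fin 2} (hF : Continuous F) (he : Continuous e)
    (hsurj : ∀ w i, ∃ u, F u = w ∧ e u = i)
    (hinj : ∀ u v, (∀ n, e (F^[n] u) = e (F^[n] v)) → u = v) :
    ∃ h : X ≃ₜ (ℕ → Fin 2), ∀ x, h (F x) = shift2 (h x) := by
  let c : X → ℕ → Fin 2 := fun x n => e (F^[n] x)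
  have hc : Continuous c := continuous_pi fun n => he.comp (hF.iterate n)
  have hword : ∀ (n : ℕ) (s : ℕ → Fin 2), ∃ x, ∀ i < n, c x i = s i := by
    intro n
    induction n with
    | zero => exact fun s => ⟨Classical.arbitrary X, fun i hi => absurd hi (Nat.not_lt_zero i)⟩
    | succ n ih =>
      intro s
      obtain ⟨y, hy⟩ := ih (shift2 s)
      obtain ⟨x, hx, hx0⟩ := hsurj y (s 0)
      refine ⟨x, fun i hi => ?_⟩
      cases i with
      | zero => exact hx0
      | succ i =>
        have := hy i (Nat.lt_of_succ_lt_succ hi)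
        simpa only [c, Function.iterate_succ_apply, hx, shift2] using this
  have hdense : DenseRange c := by
    refine (PiNat.isTopologicalBasis_cylinders fun _ : ℕ => Fin 2).dense_iff.2 ?_
    rintro _ ⟨s, n, rfl⟩ -
    obtain ⟨x, hx⟩ := hword n s
    exact ⟨c x, hx, x, rfl⟩
  have hbij : Function.Bijective c :=
    ⟨fun u v huv => hinj u v fun n => congrFun huv n, fun s => by
      have := (isCompact_range hc).isClosed.closure_eq
      rw [hdense.closure_range] at this
      exact (this ▸ Set.mem_univ s : s ∈ Set.range c)⟩
  exact ⟨Continuous.homeoOfEquivCompactToT2 (f := Equiv.ofBijective c hbij) hc, fun x => rfl⟩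

/-! ### The Julia set -/

/-- The points of `ℚ₂` whose whole orbit under `phi a` stays on the sphere of radius
`1 / √‖a‖`. -/
def juliaSet (a : ℚ_[2]) : Set ℚ_[2] := {x | ∀ n : ℕ, ‖(phi a)^[n] x‖ = 1 / Real.sqrt ‖a‖}

lemma mem_juliaSet_iff {a x : ℚ_[2]} :
    x ∈ juliaSet a ↔ ‖x‖ = 1 / Real.sqrt ‖a‖ ∧ phi a x ∈ juliaSet a := by
  refine ⟨fun h => ⟨h 0, fun n => h (n + 1)⟩, fun h n => ?_⟩
  cases n with
  | zero => exact h.1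
  | succ n => exact h.2 n

lemma norm_eq_one_div_sqrt_iff {a : ℚ_[2]} (ha : 1 < ‖a‖) (x : ℚ_[2]) :
    ‖x‖ = 1 / Real.sqrt ‖a‖ ↔ ‖a‖ * ‖x‖ ^ 2 = 1 := by
  have hs : 0 < Real.sqrt ‖a‖ := Real.sqrt_pos.2 (by linarith)
  rw [eq_div_iff hs.ne', ← pow_left_inj₀ (by positivity) zero_le_one two_ne_zero, mul_pow,
    Real.sq_sqrt (norm_nonneg a), one_pow, mul_comm]

lemma norm_sq_of_sq_eq_one_sub {a b : ℚ_[2]} (ha : 1 < ‖a‖) (hb : b ^ 2 = 1 - a) :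
    ‖b‖ ^ 2 = ‖a‖ := by
  rw [← norm_pow, hb, sub_eq_add_neg,
    Padic.add_eq_max_of_ne (by rw [norm_neg, norm_one]; exact ha.ne), norm_neg, norm_one]
  exact max_eq_right ha.le

lemma ne_zero_of_sq_eq_one_sub {a b : ℚ_[2]} (ha : 1 < ‖a‖) (hb : b ^ 2 = 1 - a) : b ≠ 0 := by
  rintro rfl
  have := norm_sq_of_sq_eq_one_sub ha hb
  simp only [norm_zero] at this
  linarith

lemma norm_mul_eq_one_iff {a b : ℚ_[2]} (ha : 1 < ‖a‖) (hb : b ^ 2 = 1 - a) (x : ℚ_[2]) :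
    ‖b * x‖ = 1 ↔ ‖x‖ = 1 / Real.sqrt ‖a‖ := by
  rw [norm_eq_one_div_sqrt_iff ha, ← norm_sq_of_sq_eq_one_sub ha hb, ← mul_pow, ← norm_mul,
    pow_eq_one_iff_of_nonneg (norm_nonneg _) two_ne_zero]

lemma four_le_norm {a b : ℚ_[2]} (ha : 1 < ‖a‖) (hb : b ^ 2 = 1 - a) : 4 ≤ ‖a‖ := by
  have h := norm_sq_of_sq_eq_one_sub ha hb
  have h1 : 1 < ‖b‖ := by nlinarith [norm_nonneg b]
  nlinarith [Padic.two_le_norm_of_one_lt_norm h1]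

lemma ne_zero_of_norm_eq_one_div_sqrt {a x : ℚ_[2]} (ha : 1 < ‖a‖)
    (hx : ‖x‖ = 1 / Real.sqrt ‖a‖) : x ≠ 0 :=
  norm_ne_zero_iff.1 (hx ▸ (one_div_pos.2 (Real.sqrt_pos.2 (by linarith))).ne')

lemma continuousOn_phi {a : ℚ_[2]} (ha : 1 < ‖a‖) :
    ContinuousOn (phi a) (Metric.sphere 0 (1 / Real.sqrt ‖a‖)) :=
  (continuousOn_const.mul continuousOn_id).add (continuousOn_inv₀.mono fun _ hx =>
    ne_zero_of_norm_eq_one_div_sqrt ha (mem_sphere_zero_iff_norm.1 hx))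

lemma isClosed_juliaSet {a : ℚ_[2]} (ha : 1 < ‖a‖) : IsClosed (juliaSet a) := by
  have hclosed : ∀ n, IsClosed {x | ∀ i < n, ‖(phi a)^[i] x‖ = 1 / Real.sqrt ‖a‖} := by
    intro n
    induction n with
    | zero => simp
    | succ n ih =>
      convert (continuousOn_phi ha).preimage_isClosed_of_isClosed Metric.isClosed_sphere ih using 1
      ext x
      simp only [Set.mem_ofPred_eq, Set.mem_inter_iff, mem_sphere_iff_norm, sub_zero,
        Set.mem_preimage, Nat.forall_lt_succ_left, Function.iterate_zero, id_eq,
        Function.iterate_succ_apply]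
  convert isClosed_iInter hclosed using 1
  ext x
  simp only [juliaSet, Set.mem_ofPred_eq, Set.mem_iInter]
  exact ⟨fun h n i _ => h i, fun h n => h (n + 1) n n.lt_succ_self⟩

lemma isCompact_juliaSet {a : ℚ_[2]} (ha : 1 < ‖a‖) : IsCompact (juliaSet a) :=
  (isCompact_closedBall (0 : ℚ_[2]) (1 / Real.sqrt ‖a‖)).of_isClosed_subset (isClosed_juliaSet ha)
    fun x hx => by simpa using (hx 0).le

/-- The letter of a point is its residue class modulo `4` after multiplication by `b`. -/
noncomputable def letter (b x : ℚ_[2]) : Fin 2 :=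
  (Metric.closedBall (1 : ℚ_[2]) (1 / 4)).indicator 1 (b * x)

lemma letter_eq_one_iff {b x : ℚ_[2]} : letter b x = 1 ↔ ‖b * x - 1‖ ≤ 1 / 4 := by
  classical
  rw [letter, Set.indicator_apply]
  simp [dist_eq_norm]

lemma continuous_letter (b : ℚ_[2]) : Continuous (letter b) :=
  ((IsUltrametricDist.isClopen_closedBall (1 : ℚ_[2]) (by norm_num)).continuous_indicator
    continuous_const).comp (continuous_const.mul continuous_id)

lemma norm_sub_le_of_letter_eq {b x y : ℚ_[2]} (hx : ‖b * x‖ = 1) (hy : ‖b * y‖ = 1)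
    (hxy : letter b x = letter b y) : ‖b * x - b * y‖ ≤ 1 / 4 := by
  have hiff : ‖b * x - 1‖ ≤ 1 / 4 ↔ ‖b * y - 1‖ ≤ 1 / 4 := by
    rw [← letter_eq_one_iff, ← letter_eq_one_iff, hxy]
  by_cases h : ‖b * x - 1‖ ≤ 1 / 4
  · rw [show b * x - b * y = (b * x - 1) + -(b * y - 1) by ring]
    exact (Padic.nonarchimedean _ _).trans (max_le h (by rw [norm_neg]; exact hiff.1 h))
  · have hx' := (Padic.norm_sub_one_le_or_norm_add_one_le hx).resolve_left h
    have hy' := (Padic.norm_sub_one_le_or_norm_add_one_le hy).resolve_left (mt hiff.2 h)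
    rw [show b * x - b * y = (b * x + 1) + -(b * y + 1) by ring]
    exact (Padic.nonarchimedean _ _).trans (max_le hx' (by rwa [norm_neg]))

lemma eq_of_forall_letter_eq {a b x y : ℚ_[2]} (ha : 1 < ‖a‖) (hb : b ^ 2 = 1 - a)
    (hx : x ∈ juliaSet a) (hy : y ∈ juliaSet a)
    (h : ∀ n, letter b ((phi a)^[n] x) = letter b ((phi a)^[n] y)) : x = y := by
  have ha4 := four_le_norm ha hb
  have hclose : ∀ n, ‖b * (phi a)^[n] x - b * (phi a)^[n] y‖ ≤ 1 / 4 := fun n =>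
    norm_sub_le_of_letter_eq ((norm_mul_eq_one_iff ha hb _).2 (hx n))
      ((norm_mul_eq_one_iff ha hb _).2 (hy n)) (h n)
  have hexp : ∀ n, ‖b * (phi a)^[n] x - b * (phi a)^[n] y‖ =
      (‖a‖ / 2) ^ n * ‖b * x - b * y‖ := by
    intro n
    induction n with
    | zero => simp
    | succ n ih =>
      rw [Function.iterate_succ_apply', Function.iterate_succ_apply', mul_phi hb, mul_phi hb,
        norm_phiUnit_sub ha4 ((norm_mul_eq_one_iff ha hb _).2 (hx n))
          ((norm_mul_eq_one_iff ha hb _).2 (hy n)) (hclose n), ih]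
      ring
  have hb0 := ne_zero_of_sq_eq_one_sub ha hb
  by_contra hne
  have hpos : 0 < ‖b * x - b * y‖ :=
    norm_pos_iff.2 (sub_ne_zero.2 fun h => hne (mul_left_cancel₀ hb0 h))
  obtain ⟨n, hn⟩ := pow_unbounded_of_one_lt (1 / ‖b * x - b * y‖)
    (show 1 < ‖a‖ / 2 by linarith)
  rw [div_lt_iff₀ hpos] at hn
  have := hclose n
  rw [hexp] at this
  linarith

lemma exists_phi_eq_and_letter_eq {a b w : ℚ_[2]} (ha : 1 < ‖a‖) (hb : b ^ 2 = 1 - a)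
    (hw : w ∈ juliaSet a) (i : Fin 2) : ∃ x ∈ juliaSet a, phi a x = w ∧ letter b x = i := by
  have hb0 := ne_zero_of_sq_eq_one_sub ha hb
  have ha4 := four_le_norm ha hb
  have hw1 : ‖b * w‖ = 1 := (norm_mul_eq_one_iff ha hb w).2 (hw 0)
  have lift : ∀ u, ‖u‖ = 1 → phiUnit a u = b * w →
      b⁻¹ * u ∈ juliaSet a ∧ phi a (b⁻¹ * u) = w := by
    intro u hu huw
    have hphi : phi a (b⁻¹ * u) = w :=
      mul_left_cancel₀ hb0 (by rw [mul_phi hb, mul_inv_cancel_left₀ hb0, huw])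
    refine ⟨mem_juliaSet_iff.2 ⟨?_, hphi.symm ▸ hw⟩, hphi⟩
    rwa [← norm_mul_eq_one_iff ha hb, mul_inv_cancel_left₀ hb0]
  rcases eq_or_ne i 1 with rfl | hi
  · obtain ⟨u, hu, huw⟩ := exists_phiUnit_eq ha4 hw1
    obtain ⟨hmem, hphi⟩ := lift u
      (Padic.norm_eq_one_of_norm_sub_one_lt (hu.trans_lt (by norm_num))) huw
    exact ⟨_, hmem, hphi, letter_eq_one_iff.2 (by rwa [mul_inv_cancel_left₀ hb0])⟩
  · obtain ⟨u, hu, huw⟩ := exists_phiUnit_eq (w := -(b * w)) ha4 (by rwa [norm_neg])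
    obtain ⟨hmem, hphi⟩ := lift (-u)
      (by rw [norm_neg, Padic.norm_eq_one_of_norm_sub_one_lt (hu.trans_lt (by norm_num))])
      (by rw [phiUnit_neg, huw, neg_neg])
    have hne : letter b (b⁻¹ * -u) ≠ 1 := by
      rw [Ne, letter_eq_one_iff, mul_inv_cancel_left₀ hb0, show -u - 1 = -(u + 1) by ring, norm_neg,
        Padic.norm_add_one_eq_half hu]
      norm_num
    exact ⟨_, hmem, hphi, by omega⟩

/-- The fixed point `1 / b` of `phi a` lies in the Julia set. -/
lemma inv_mem_juliaSet {a b : ℚ_[2]} (ha : 1 < ‖a‖) (hb : b ^ 2 = 1 - a) :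
    b⁻¹ ∈ juliaSet a := by
  have hb0 := ne_zero_of_sq_eq_one_sub ha hb
  have hfix : phi a b⁻¹ = b⁻¹ := by
    rw [phi, inv_inv]
    field_simp
    linear_combination hb
  intro n
  rw [Function.iterate_fixed hfix, ← norm_mul_eq_one_iff ha hb, mul_inv_cancel₀ hb0, norm_one]

/-! ### Escape to infinity -/

lemma psi_coe {a x : ℚ_[2]} (hx : x ≠ 0) : psi a (x : OnePoint ℚ_[2]) = (phi a x : ℚ_[2]) :=
  if_neg hx

lemma psi_zero (a : ℚ_[2]) : psi a ((0 : ℚ_[2]) : OnePoint ℚ_[2]) = ∞ := if_pos rfl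

lemma psi_infty (a : ℚ_[2]) : psi a ∞ = ∞ := rfl

lemma tendsto_iterate_of_tendsto_iterate_apply {α : Type*} {f : α → α} {x : α} {l : Filter α}
    (m : ℕ) (h : Tendsto (fun n => f^[n] (f^[m] x)) atTop l) :
    Tendsto (fun n => f^[n] x) atTop l :=
  (tendsto_add_atTop_iff_nat m).1 (by simpa only [Function.iterate_add_apply] using h)

lemma norm_phi_of_one_lt {a x : ℚ_[2]} (hx : 1 < ‖a‖ * ‖x‖ ^ 2) : ‖phi a x‖ = ‖a‖ * ‖x‖ := by
  have hx0 : 0 < ‖x‖ := (norm_nonneg x).lt_of_ne' fun h => by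
    rw [h] at hx; norm_num at hx
  have hlt : ‖x⁻¹‖ < ‖a * x‖ := by
    rw [norm_inv, norm_mul, inv_lt_iff_one_lt_mul₀ hx0]; linarith
  rw [phi, Padic.add_eq_max_of_ne hlt.ne', max_eq_left hlt.le, norm_mul]

lemma norm_phi_of_lt_one {a x : ℚ_[2]} (hx0 : x ≠ 0) (hx : ‖a‖ * ‖x‖ ^ 2 < 1) :
    ‖phi a x‖ = ‖x‖⁻¹ := by
  have hlt : ‖a * x‖ < ‖x⁻¹‖ := by
    have hpos : 0 < ‖x‖ := norm_pos_iff.2 hx0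
    rw [norm_inv, norm_mul, ← one_div, lt_div_iff₀ hpos]
    linarith
  rw [phi, Padic.add_eq_max_of_ne hlt.ne, max_eq_right hlt.le, norm_inv]

lemma tendsto_psi_of_one_lt {a x : ℚ_[2]} (ha : 1 < ‖a‖) (hx : 1 < ‖a‖ * ‖x‖ ^ 2) :
    Tendsto (fun n => (psi a)^[n] (x : OnePoint ℚ_[2])) atTop (𝓝 ∞) := by
  have hiter : ∀ n, (psi a)^[n] (x : OnePoint ℚ_[2]) = ((phi a)^[n] x : ℚ_[2]) ∧
      ‖(phi a)^[n] x‖ = ‖a‖ ^ n * ‖x‖ := by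
    intro n
    induction n with
    | zero => simp
    | succ n ih =>
      have hgt : 1 < ‖a‖ * ‖(phi a)^[n] x‖ ^ 2 := by
        rw [ih.2, mul_pow]
        have h1 : 1 ≤ (‖a‖ ^ n) ^ 2 := one_le_pow₀ (one_le_pow₀ ha.le)
        nlinarith
      have hne : (phi a)^[n] x ≠ 0 := fun h => by
        rw [h] at hgt; norm_num at hgt
      rw [Function.iterate_succ_apply', Function.iterate_succ_apply', ih.1, psi_coe hne,
        norm_phi_of_one_lt hgt, ih.2]
      exact ⟨rfl, by ring⟩
  have hx0 : 0 < ‖x‖ := (norm_nonneg x).lt_of_ne' fun h => by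
    rw [h] at hx; norm_num at hx
  have hnorm : Tendsto (fun n => ‖(phi a)^[n] x‖) atTop atTop := by
    simp only [fun n => (hiter n).2]
    exact (tendsto_pow_atTop_atTop_of_one_lt ha).atTop_mul_const hx0
  rw [tendsto_norm_atTop_iff_cobounded, Metric.cobounded_eq_cocompact,
    ← coclosedCompact_eq_cocompact] at hnorm
  simp only [fun n => (hiter n).1]
  exact OnePoint.tendsto_coe_infty.comp hnorm

lemma tendsto_psi_of_norm_ne {a x : ℚ_[2]} (ha : 1 < ‖a‖) (hx : ‖x‖ ≠ 1 / Real.sqrt ‖a‖) :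
    Tendsto (fun n => (psi a)^[n] (x : OnePoint ℚ_[2])) atTop (𝓝 ∞) := by
  rcases eq_or_ne x 0 with rfl | hx0
  · refine tendsto_iterate_of_tendsto_iterate_apply 1 ?_
    rw [Function.iterate_one, psi_zero]
    simp only [Function.iterate_fixed (psi_infty a), tendsto_const_nhds]
  rw [Ne, norm_eq_one_div_sqrt_iff ha] at hx
  rcases lt_or_gt_of_ne hx with hlt | hgt
  · refine tendsto_iterate_of_tendsto_iterate_apply 1 ?_
    rw [Function.iterate_one, psi_coe hx0]
    refine tendsto_psi_of_one_lt ha ?_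
    have hpos : 0 < ‖x‖ ^ 2 := by positivity
    rw [norm_phi_of_lt_one hx0 hlt, inv_pow, ← div_eq_mul_inv, one_lt_div hpos]
    nlinarith
  · exact tendsto_psi_of_one_lt ha hgt

lemma tendsto_psi_of_notMem_juliaSet {a x : ℚ_[2]} (ha : 1 < ‖a‖) (hx : x ∉ juliaSet a) :
    Tendsto (fun n => (psi a)^[n] (x : OnePoint ℚ_[2])) atTop (𝓝 ∞) := by
  simp only [juliaSet, Set.mem_ofPred_eq, not_forall] at hx
  obtain ⟨n, hn⟩ := hx
  induction n generalizing x with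
  | zero => exact tendsto_psi_of_norm_ne ha hn
  | succ n ih =>
    by_cases h : ‖x‖ = 1 / Real.sqrt ‖a‖
    · refine tendsto_iterate_of_tendsto_iterate_apply 1 ?_
      rw [Function.iterate_one, psi_coe (ne_zero_of_norm_eq_one_div_sqrt ha h)]
      exact ih hn
    · exact tendsto_psi_of_norm_ne ha h

theorem stmt_5 (a : ℚ_[2]) (ha : 1 < ‖a‖) (hsq : ∃ b : ℚ_[2], b ^ 2 = 1 - a) :
    ∀ J : Set ℚ_[2],
      J = {x : ℚ_[2] | ∀ n : ℕ, ‖(phi a)^[n] x‖ = 1 / Real.sqrt ‖a‖} →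
      Set.MapsTo (phi a) J J ∧
      (∃ h : J ≃ₜ (ℕ → Fin 2),
        ∀ (x : J) (hx : phi a (x : ℚ_[2]) ∈ J),
          h ⟨phi a (x : ℚ_[2]), hx⟩ = shift2 (h x)) ∧
      (∀ x : ℚ_[2], x ∉ J →
        Tendsto (fun n => (psi a)^[n] (x : OnePoint ℚ_[2])) atTop
          (𝓝 (∞ : OnePoint ℚ_[2]))) := by
  intro J hJ
  change J = juliaSet a at hJ
  subst hJ
  obtain ⟨b, hb⟩ := hsq
  have hmaps : Set.MapsTo (phi a) (juliaSet a) (juliaSet a) := fun x hx =>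
    (mem_juliaSet_iff.1 hx).2
  refine ⟨hmaps, ?_, fun x hx => tendsto_psi_of_notMem_juliaSet ha hx⟩
  have : CompactSpace (juliaSet a) := isCompact_iff_compactSpace.1 (isCompact_juliaSet ha)
  have : Nonempty (juliaSet a) := ⟨⟨b⁻¹, inv_mem_juliaSet ha hb⟩⟩
  have hcont : ContinuousOn (phi a) (juliaSet a) := (continuousOn_phi ha).mono fun _ hx =>
    mem_sphere_zero_iff_norm.2 (hx 0)
  obtain ⟨h, hh⟩ := exists_homeomorph_shift2 (F := hmaps.restrict) (e := fun x => letter b x)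
    (hcont.mapsToRestrict hmaps) ((continuous_letter b).comp continuous_subtype_val)
    (fun w i => by
      obtain ⟨x, hx, hxw, hxi⟩ := exists_phi_eq_and_letter_eq ha hb w.2 i
      exact ⟨⟨x, hx⟩, Subtype.ext hxw, hxi⟩)
    (fun x y hxy => Subtype.ext (eq_of_forall_letter_eq ha hb x.2 y.2 fun n => by
      simpa only [hmaps.iterate_restrict, Set.MapsTo.val_restrict_apply] using hxy n))
  exact ⟨h, fun x _ => hh x⟩
end

section
/- Let a ∈ ℚ₂ with a ≠ 0 and ‖a‖ = 2^(-2m) for an integer m ≥ 1, and suppose there exists c ∈ ℚ₂ with a = 3·c² (i.e. √(-a) ∈ ℚ₂(√(-3))). Then for all x, y lying in closedBall(2^(-m), 2^(m-2)) (or both lying in closedBall(-2^(-m), 2^(m-2))), one has ‖φ(x) - φ(y)‖ = (‖a‖/2)·‖x - y‖; moreover φ '' closedBall(2^(-m), 2^(m-2)) = φ '' closedBall(-2^(-m), 2^(m-2)) = {z ∈ ℚ₂ : ‖z‖ = 2^(-(m+2))}, the sphere S(0, √‖a‖/4). -/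
open Metric Set

@[simp, norm_cast]
theorem PadicInt.coe_ofNat {p : ℕ} [Fact p.Prime] (n : ℕ) [n.AtLeastTwo] :
    ((ofNat(n) : ℤ_[p]) : ℚ_[p]) = ofNat(n) :=
  PadicInt.coe_natCast n

theorem PadicInt.norm_one_add_two_mul (r : ℤ_[2]) : ‖1 + 2 * r‖ = 1 := by
  refine le_antisymm (norm_le_one _) (not_lt.1 fun h => ?_)
  have h1 : ((2 : ℕ) : ℤ_[2]) ∣ 1 := by
    refine (dvd_add_left ?_).1 ((norm_lt_one_iff_dvd _).1 h)
    exact ⟨r, by push_cast; rfl⟩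
  simpa using (norm_lt_one_iff_dvd (1 : ℤ_[2])).2 h1

theorem PadicInt.eq_two_mul_or_one_add_two_mul (s : ℤ_[2]) :
    ∃ r, s = 2 * r ∨ s = 1 + 2 * r := by
  obtain ⟨n, hn, h⟩ := exists_mem_range s
  rw [maximalIdeal_eq_span_p, Ideal.mem_span_singleton] at h
  obtain ⟨r, hr⟩ := h
  push_cast at hr
  refine ⟨r, ?_⟩
  interval_cases n
  · left; simpa using hr
  · right; rw [← hr]; push_cast; ring

theorem PadicInt.exists_eq_one_add_two_mul {s : ℤ_[2]} (hs : ‖s‖ = 1) :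
    ∃ r, s = 1 + 2 * r := by
  obtain ⟨r, rfl | h⟩ := s.eq_two_mul_or_one_add_two_mul
  · have : ‖2 * r‖ < 1 := (norm_lt_one_iff_dvd _).2 ⟨r, by push_cast; rfl⟩
    exact absurd hs this.ne
  · exact ⟨r, h⟩

theorem PadicInt.exists_sq_eq_one_add_eight_mul {s : ℤ_[2]} (hs : ‖s‖ = 1) :
    ∃ r, s ^ 2 = 1 + 8 * r := by
  obtain ⟨q, rfl⟩ := exists_eq_one_add_two_mul hs
  obtain ⟨r, rfl | rfl⟩ := q.eq_two_mul_or_one_add_two_mul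
  · exact ⟨r + 2 * r ^ 2, by ring⟩
  · exact ⟨1 + 3 * r + 2 * r ^ 2, by ring⟩

open Polynomial in
theorem PadicInt.exists_root_two_mul_sq (p q r : ℤ_[2]) :
    ∃ t : ℤ_[2], 2 * p * t ^ 2 + (1 + 2 * q) * t + r = 0 := by
  let F : ℤ_[2][X] := C (2 * p) * X ^ 2 + C (1 + 2 * q) * X + C r
  have hF (x : ℤ_[2]) : F.eval x = 2 * p * x ^ 2 + (1 + 2 * q) * x + r := by simp [F]
  have hF' (x : ℤ_[2]) : F.derivative.eval x = 1 + 2 * (q + 2 * p * x) := by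
    simp [F]; ring
  obtain ⟨t, ht, -⟩ := hensels_lemma (F := F) (a := -r) (by
    change ‖F.eval (-r)‖ < ‖F.derivative.eval (-r)‖ ^ 2
    rw [hF, hF', norm_one_add_two_mul, one_pow]
    refine (norm_lt_one_iff_dvd _).2 ⟨p * r ^ 2 - q * r, ?_⟩
    push_cast
    ring)
  exact ⟨t, (hF t).symm.trans ht⟩

theorem Padic.norm_one_add_two_mul (r : ℤ_[2]) : ‖(1 + 2 * r : ℚ_[2])‖ = 1 := by
  have h := r.norm_one_add_two_mul
  rw [PadicInt.norm_def] at h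
  exact_mod_cast h

theorem Padic.norm_two_zpow (n : ℤ) : ‖(2 : ℚ_[2]) ^ n‖ = (2 : ℝ) ^ (-n) := by
  simpa using Padic.norm_p_zpow (p := 2) n

theorem Padic.norm_le_two_zpow_iff {x : ℚ_[2]} {n : ℤ} :
    ‖x‖ ≤ (2 : ℝ) ^ n ↔ ∃ t : ℤ_[2], x = 2 ^ (-n) * t := by
  constructor
  · intro h
    refine ⟨⟨2 ^ n * x, ?_⟩, ?_⟩
    · rw [norm_mul, norm_two_zpow, zpow_neg, inv_mul_le_iff₀ (by positivity), mul_one]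
      exact h
    · rw [zpow_neg, inv_mul_cancel_left₀ (zpow_ne_zero _ two_ne_zero)]
  · rintro ⟨t, rfl⟩
    rw [norm_mul, norm_two_zpow, neg_neg]
    exact mul_le_of_le_one_right (by positivity) t.norm_le_one

theorem Padic.norm_eq_two_zpow_iff {x : ℚ_[2]} {n : ℤ} :
    ‖x‖ = (2 : ℝ) ^ n ↔ ∃ t : ℤ_[2], x = 2 ^ (-n) * (1 + 2 * t) := by
  constructor
  · intro h
    obtain ⟨s, rfl⟩ := norm_le_two_zpow_iff.1 h.le
    rw [norm_mul, norm_two_zpow, neg_neg, mul_eq_left₀ (by positivity)] at h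
    obtain ⟨r, rfl⟩ := PadicInt.exists_eq_one_add_two_mul (s := s) h
    exact ⟨r, by push_cast; rfl⟩
  · rintro ⟨t, rfl⟩
    rw [norm_mul, norm_two_zpow, neg_neg, norm_one_add_two_mul, mul_one]

theorem Padic.one_add_four_mul_ne_zero (t : ℤ_[2]) : (1 + 4 * t : ℚ_[2]) ≠ 0 := by
  intro h
  have h1 := norm_one_add_two_mul (2 * t)
  push_cast at h1
  rw [← mul_assoc, show (2 * 2 : ℚ_[2]) = 4 by norm_num, h] at h1
  simp at h1

theorem Padic.mem_closedBall_two_zpow_iff {m : ℤ} {x : ℚ_[2]} :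
    x ∈ closedBall ((2 : ℚ_[2]) ^ (-m)) ((2 : ℝ) ^ (m - 2)) ↔
      ∃ t : ℤ_[2], x = 2 ^ (-m) * (1 + 4 * t) := by
  rw [mem_closedBall_iff_norm, norm_le_two_zpow_iff]
  refine exists_congr fun t => ?_
  rw [show -(m - 2) = -m + 2 by ring, zpow_add₀ two_ne_zero, sub_eq_iff_eq_add]
  constructor <;> (rintro rfl; norm_num; ring)

theorem Padic.exists_eq_of_eq_three_mul_sq {a c : ℚ_[2]} {m : ℤ}
    (ha : ‖a‖ = (2 : ℝ) ^ (-(2 * m))) (hc : a = 3 * c ^ 2) :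
    ∃ k : ℤ_[2], a = (2 ^ m) ^ 2 * (3 + 8 * k) := by
  have h3 : ‖(3 : ℚ_[2])‖ = 1 := by
    have h := norm_one_add_two_mul 1
    norm_num at h
    exact h
  have hcn : ‖c‖ = (2 : ℝ) ^ (-m) := by
    rw [hc, norm_mul, h3, one_mul, norm_pow, show -(2 * m) = -m * (2 : ℕ) by push_cast; ring,
      zpow_mul, zpow_natCast] at ha
    exact (pow_left_inj₀ (norm_nonneg c) (by positivity) two_ne_zero).1 ha
  obtain ⟨t, rfl⟩ := norm_eq_two_zpow_iff.1 hcn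
  obtain ⟨r, hr⟩ := PadicInt.exists_sq_eq_one_add_eight_mul t.norm_one_add_two_mul
  have hr' : (1 + 2 * t : ℚ_[2]) ^ 2 = 1 + 8 * r := by
    simpa using congrArg ((↑) : ℤ_[2] → ℚ_[2]) hr
  refine ⟨3 * r, ?_⟩
  rw [hc, mul_pow, hr', neg_neg]
  push_cast
  ring

theorem phi_neg (a x : ℚ_[2]) : phi a (-x) = -phi a x := by
  simp only [phi, inv_neg]
  ring

theorem phi_two_zpow_mul (b u : ℚ_[2]) (m : ℤ) :
    phi ((2 ^ m) ^ 2 * b) (2 ^ (-m) * u) = 2 ^ m * (b * u + u⁻¹) := by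
  have h : (2 : ℚ_[2]) ^ m ≠ 0 := zpow_ne_zero _ two_ne_zero
  rw [phi, zpow_neg, mul_inv, inv_inv]
  field_simp

theorem norm_phi_sub_phi {a : ℚ_[2]} {m : ℤ} {k : ℤ_[2]}
    (ha : ‖a‖ = (2 : ℝ) ^ (-(2 * m))) (hk : a = (2 ^ m) ^ 2 * (3 + 8 * k)) {x y : ℚ_[2]}
    (hx : x ∈ closedBall ((2 : ℚ_[2]) ^ (-m)) ((2 : ℝ) ^ (m - 2)))
    (hy : y ∈ closedBall ((2 : ℚ_[2]) ^ (-m)) ((2 : ℝ) ^ (m - 2))) :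
    ‖phi a x - phi a y‖ = ‖a‖ / 2 * ‖x - y‖ := by
  obtain ⟨s, rfl⟩ := Padic.mem_closedBall_two_zpow_iff.1 hx
  obtain ⟨t, rfl⟩ := Padic.mem_closedBall_two_zpow_iff.1 hy
  have hs := Padic.one_add_four_mul_ne_zero s
  have ht := Padic.one_add_four_mul_ne_zero t
  have hs1 := Padic.norm_one_add_two_mul (2 * s)
  have ht1 := Padic.norm_one_add_two_mul (2 * t)
  have hn := Padic.norm_one_add_two_mul
    (2 * k * (1 + 4 * s) * (1 + 4 * t) + 3 * (s + t + 4 * s * t))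
  push_cast at hs1 ht1 hn
  have key : phi a (2 ^ (-m) * (1 + 4 * s)) - phi a (2 ^ (-m) * (1 + 4 * t)) =
      (2 ^ m) ^ 2 * 2 * (2 ^ (-m) * (1 + 4 * s) - 2 ^ (-m) * (1 + 4 * t)) *
      (1 + 2 * (2 * k * (1 + 4 * s) * (1 + 4 * t) + 3 * (s + t + 4 * s * t))) /
      ((1 + 2 * (2 * s)) * (1 + 2 * (2 * t))) := by
    rw [hk, phi_two_zpow_mul, phi_two_zpow_mul, zpow_neg,
      show (1 + 2 * (2 * s) : ℚ_[2]) = 1 + 4 * s by ring,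
      show (1 + 2 * (2 * t) : ℚ_[2]) = 1 + 4 * t by ring]
    field_simp
    ring
  have h2n : ‖(2 : ℚ_[2])‖ = 2⁻¹ := by simpa using Padic.norm_two_zpow 1
  rw [key, norm_div, norm_mul, norm_mul, norm_mul, norm_mul (1 + 2 * (2 * s) : ℚ_[2]), hs1, ht1,
    hn, norm_pow, Padic.norm_two_zpow, h2n, ha, ← zpow_natCast, ← zpow_mul,
    show -m * ((2 : ℕ) : ℤ) = -(2 * m) by push_cast; ring]
  ring

theorem image_phi_closedBall {a : ℚ_[2]} {m : ℤ} {k : ℤ_[2]}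
    (hk : a = (2 ^ m) ^ 2 * (3 + 8 * k)) :
    phi a '' closedBall ((2 : ℚ_[2]) ^ (-m)) ((2 : ℝ) ^ (m - 2)) =
      {z : ℚ_[2] | ‖z‖ = (2 : ℝ) ^ (-(m + 2))} := by
  have h4 : (2 : ℚ_[2]) ^ (m + 2) = 2 ^ m * 4 := by
    rw [zpow_add₀ two_ne_zero]
    norm_num
  ext z
  simp only [mem_image, mem_ofPred_eq]
  constructor
  · rintro ⟨x, hx, rfl⟩
    obtain ⟨t, rfl⟩ := Padic.mem_closedBall_two_zpow_iff.1 hx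
    have ht := Padic.one_add_four_mul_ne_zero t
    have ht1 := Padic.norm_one_add_two_mul (2 * t)
    have hn := Padic.norm_one_add_two_mul (3 * t + 6 * t ^ 2 + k * (1 + 4 * t) ^ 2)
    push_cast at ht1 hn
    rw [show (1 + 2 * (2 * t) : ℚ_[2]) = 1 + 4 * t by ring] at ht1
    have key : phi a (2 ^ (-m) * (1 + 4 * t)) = 2 ^ (m + 2) *
        (1 + 2 * (3 * t + 6 * t ^ 2 + k * (1 + 4 * t) ^ 2)) / (1 + 4 * t) := by
      rw [hk, phi_two_zpow_mul, h4]
      field_simp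
      ring
    rw [key, norm_div, norm_mul, hn, ht1, Padic.norm_two_zpow, mul_one, div_one]
  · intro hz
    obtain ⟨w, rfl⟩ := Padic.norm_eq_two_zpow_iff.1 hz
    obtain ⟨t, ht⟩ := PadicInt.exists_root_two_mul_sq (3 + 8 * k) (4 * k - 2 * w) (k - w)
    have ht' : (2 * (3 + 8 * k) * t ^ 2 + (1 + 2 * (4 * k - 2 * w)) * t + (k - w) : ℚ_[2]) =
        0 := by
      simpa using congrArg ((↑) : ℤ_[2] → ℚ_[2]) ht
    have ht0 := Padic.one_add_four_mul_ne_zero t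
    refine ⟨_, Padic.mem_closedBall_two_zpow_iff.2 ⟨t, rfl⟩, ?_⟩
    rw [hk, phi_two_zpow_mul, neg_neg, h4, mul_assoc]
    congr 1
    field_simp
    linear_combination 8 * ht'

theorem stmt_11 (a : ℚ_[2]) (ha0 : a ≠ 0) (m : ℤ) (hm : 1 ≤ m)
    (ha : ‖a‖ = (2 : ℝ) ^ (-(2 * m)))
    (hsq3 : ∃ c : ℚ_[2], a = 3 * c ^ 2) :
    (∀ x y : ℚ_[2],
      ((x ∈ closedBall ((2 : ℚ_[2]) ^ (-m)) ((2 : ℝ) ^ (m - 2)) ∧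
        y ∈ closedBall ((2 : ℚ_[2]) ^ (-m)) ((2 : ℝ) ^ (m - 2))) ∨
       (x ∈ closedBall (-(2 : ℚ_[2]) ^ (-m)) ((2 : ℝ) ^ (m - 2)) ∧
        y ∈ closedBall (-(2 : ℚ_[2]) ^ (-m)) ((2 : ℝ) ^ (m - 2)))) →
      ‖phi a x - phi a y‖ = ‖a‖ / 2 * ‖x - y‖) ∧
    phi a '' closedBall ((2 : ℚ_[2]) ^ (-m)) ((2 : ℝ) ^ (m - 2)) =
      {z : ℚ_[2] | ‖z‖ = (2 : ℝ) ^ (-(m + 2))} ∧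
    phi a '' closedBall (-(2 : ℚ_[2]) ^ (-m)) ((2 : ℝ) ^ (m - 2)) =
      {z : ℚ_[2] | ‖z‖ = (2 : ℝ) ^ (-(m + 2))} := by
  obtain ⟨c, hc⟩ := hsq3
  obtain ⟨k, hk⟩ := Padic.exists_eq_of_eq_three_mul_sq ha hc
  have hball (x : ℚ_[2]) : x ∈ closedBall (-(2 : ℚ_[2]) ^ (-m)) ((2 : ℝ) ^ (m - 2)) ↔
      -x ∈ closedBall ((2 : ℚ_[2]) ^ (-m)) ((2 : ℝ) ^ (m - 2)) := by
    rw [mem_closedBall_iff_norm, mem_closedBall_iff_norm, ← norm_neg, neg_sub', neg_neg]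
  refine ⟨?_, image_phi_closedBall hk, ?_⟩
  · rintro x y (⟨hx, hy⟩ | ⟨hx, hy⟩)
    · exact norm_phi_sub_phi ha hk hx hy
    · have h := norm_phi_sub_phi ha hk ((hball x).1 hx) ((hball y).1 hy)
      rwa [phi_neg, phi_neg, ← neg_sub', ← neg_sub', norm_neg, norm_neg] at h
  · ext z
    have h := Set.ext_iff.1 (image_phi_closedBall hk) (-z)
    simp only [mem_ofPred_eq, norm_neg] at h
    rw [mem_ofPred_eq, ← h]
    constructor
    · rintro ⟨x, hx, rfl⟩
      exact ⟨-x, (hball x).1 hx, phi_neg a x⟩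
    · rintro ⟨x, hx, hxz⟩
      refine ⟨-x, (hball _).2 (by rwa [neg_neg]), ?_⟩
      rw [phi_neg, hxz, neg_neg]
end
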